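/- The instance of the cubic set partition problem with respect to a finite nonempty set S and cost function c can be written as a cubic integer program: the minimum over all partitions Π of S of Σ_{R∈Π} Σ_{t∈binom(R,3)} c_t + Σ_{R∈Π} Σ_{p∈binom(R,2)} c_p + c_∅ equals the minimum over all x ∈ X_S of φ_c(x). Moreover, the map sending a partition Π to the vector x with x_{pq} = 1 if and only if p and q lie in the same block of Π is a bijection from the set of partitions of S onto X_S under which the two objective values coincide. -/

import Mathlib

open Finset

/-- `binom(S,2)`: the set of 2-element subsets (unordered pairs) of the ground set. -/
def pairs (V : Type*) [Fintype V] [DecidableEq V] : Finset (Finset V) :=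
  (univ : Finset V).powersetCard 2

/-- `binom(S,3)`: the set of 3-element subsets (unordered triples) of the ground set. -/
def triples (V : Type*) [Fintype V] [DecidableEq V] : Finset (Finset V) :=
  (univ : Finset V).powersetCard 3

/-- The feasible set `X_S`: maps `x : binom(S,2) → {0,1}` satisfying the triangle
inequalities `x_{pq} + x_{qr} - x_{pr} ≤ 1` for all pairwise distinct `p, q, r`. -/
def feasible {V : Type*} [Fintype V] [DecidableEq V] (x : Finset V → ℝ) : Prop :=
  (∀ e ∈ pairs V, x e = 0 ∨ x e = 1) ∧
    ∀ p q r : V, p ≠ q → q ≠ r → p ≠ r →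
      x {p, q} + x {q, r} - x {p, r} ≤ 1

/-- The cubic objective
`φ_c(x) = Σ_{{p,q,r}} c_{pqr} x_{pq} x_{pr} x_{qr} + Σ_{{p,q}} c_{pq} x_{pq} + c_∅`. -/
def obj {V : Type*} [Fintype V] [DecidableEq V] (c x : Finset V → ℝ) : ℝ :=
  ∑ t ∈ triples V, c t * ∏ e ∈ t.powersetCard 2, x e
    + ∑ e ∈ pairs V, c e * x e + c ∅

/-- `δ(R)`: the pairs having exactly one element in `R`. -/
def cut {V : Type*} [Fintype V] [DecidableEq V] (R : Finset V) : Finset (Finset V) :=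
  (pairs V).filter fun e => (e ∩ R).card = 1

/-- `T_{P'}`: the triples having some 2-element subset in `P'`. -/
def Tof {V : Type*} [Fintype V] [DecidableEq V] (P' : Finset (Finset V)) :
    Finset (Finset V) :=
  (triples V).filter fun t => ∃ e ∈ t.powersetCard 2, e ∈ P'

/-- The feasible vector `x^Π` of a partition `Π`: `x_{pq} = 1` iff `p` and `q` lie in the
same block of `Π` (for a pair `e = {p,q}` this is `∃ B ∈ Π, e ⊆ B`). -/
def partVec {V : Type*} [Fintype V] [DecidableEq V]
    (P : Finpartition (univ : Finset V)) : Finset V → ℝ :=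
  fun e => if ∃ B ∈ P.parts, e ⊆ B then 1 else 0

/-- The set-partition objective
`Σ_{R ∈ Π} Σ_{t ∈ binom(R,3)} c_t + Σ_{R ∈ Π} Σ_{p ∈ binom(R,2)} c_p + c_∅`. -/
def partObj {V : Type*} [Fintype V] [DecidableEq V] (c : Finset V → ℝ)
    (P : Finpartition (univ : Finset V)) : ℝ :=
  ∑ B ∈ P.parts, ∑ t ∈ B.powersetCard 3, c t
    + ∑ B ∈ P.parts, ∑ e ∈ B.powersetCard 2, c e + c ∅

section

variable {V : Type*} [Fintype V] [DecidableEq V]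

theorem exists_part_superset_iff_subset_part (P : Finpartition (univ : Finset V)) {p : V}
    {t : Finset V} (hp : p ∈ t) : (∃ B ∈ P.parts, t ⊆ B) ↔ t ⊆ P.part p := by
  constructor
  · rintro ⟨B, hB, h⟩
    rwa [P.part_eq_of_mem hB (h hp)]
  · exact fun h => ⟨_, P.part_mem.2 (mem_univ p), h⟩

theorem partVec_pair (P : Finpartition (univ : Finset V)) (p q : V) :
    partVec P {p, q} = if q ∈ P.part p then 1 else 0 := by
  refine if_congr ?_ rfl rfl
  rw [exists_part_superset_iff_subset_part P (mem_insert_self p {q}), insert_subset_iff,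
    P.mem_part_self, singleton_subset_iff]
  exact and_iff_right (mem_univ p)

theorem feasible_partVec (P : Finpartition (univ : Finset V)) : feasible (partVec P) := by
  refine ⟨fun e _ => ?_, fun p q r _ _ _ => ?_⟩
  · unfold partVec
    split_ifs <;> simp
  · have key : q ∈ P.part p → r ∈ P.part q → r ∈ P.part p := fun h₁ h₂ =>
      P.part_eq_of_mem (P.part_mem.2 (mem_univ p)) h₁ ▸ h₂
    simp only [partVec_pair]
    by_cases h₁ : q ∈ P.part p <;> by_cases h₂ : r ∈ P.part q
    · simp [h₁, h₂, key h₁ h₂]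
    all_goals split_ifs <;> norm_num

theorem Finpartition.ext_part {P Q : Finpartition (univ : Finset V)}
    (h : ∀ a, P.part a = Q.part a) : P = Q := by
  have image_part (R : Finpartition (univ : Finset V)) : R.parts = univ.image R.part := by
    ext B
    simp only [mem_image, mem_univ, true_and]
    constructor
    · intro hB
      obtain ⟨a, ha⟩ := R.nonempty_of_mem_parts hB
      exact ⟨a, R.part_eq_of_mem hB ha⟩
    · rintro ⟨a, rfl⟩
      exact R.part_mem.2 (mem_univ a)
  apply Finpartition.ext
  rw [image_part P, image_part Q, funext h]

theorem eq_of_partVec_eq_on_pairs {P Q : Finpartition (univ : Finset V)}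
    (h : ∀ e ∈ pairs V, partVec P e = partVec Q e) : P = Q := by
  refine Finpartition.ext_part fun p => ?_
  ext q
  by_cases hpq : p = q
  · subst hpq
    simp
  · have := h {p, q} (by simp [pairs, mem_powersetCard, card_pair hpq])
    simp only [partVec_pair] at this
    by_cases h₁ : q ∈ P.part p <;> by_cases h₂ : q ∈ Q.part p <;> simp_all

/-- The equivalence relation relating `p ≠ q` exactly when the feasible vector `x` joins them. -/
def feasibleSetoid {x : Finset V → ℝ} (hx : feasible x) : Setoid V where
  r p q := p = q ∨ x {p, q} = 1
  iseqv :=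
    { refl := fun _ => Or.inl rfl
      symm := by
        rintro p q (h | h)
        · exact Or.inl h.symm
        · exact Or.inr (pair_comm p q ▸ h)
      trans := by
        rintro p q r (rfl | h₁) (rfl | h₂)
        · exact Or.inl rfl
        · exact Or.inr h₂
        · exact Or.inr h₁
        · by_cases hpr : p = r
          · exact Or.inl hpr
          by_cases hpq : p = q
          · exact Or.inr (hpq ▸ h₂)
          by_cases hqr : q = r
          · exact Or.inr (hqr ▸ h₁)
          right
          have := hx.2 p q r hpq hqr hpr
          rcases hx.1 {p, r} (by simp [pairs, mem_powersetCard, card_pair hpr]) with h | h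
          · linarith
          · exact h }

theorem exists_partVec_eq_on_pairs {x : Finset V → ℝ} (hx : feasible x) :
    ∃ P : Finpartition (univ : Finset V), ∀ e ∈ pairs V, partVec P e = x e := by
  classical
  refine ⟨Finpartition.ofSetoid (feasibleSetoid hx), fun e he => ?_⟩
  have hxe := hx.1 e he
  obtain ⟨p, q, hpq, rfl⟩ := card_eq_two.1 (mem_powersetCard.1 he).2
  have hrel : feasibleSetoid hx p q ↔ x {p, q} = 1 := or_iff_right hpq
  simp only [partVec_pair, Finpartition.mem_part_ofSetoid_iff_rel, hrel]
  rcases hxe with h | h <;> simp [h]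

theorem sum_parts_powersetCard (c : Finset V → ℝ) (P : Finpartition (univ : Finset V)) {k : ℕ}
    (hk : k ≠ 0) :
    ∑ B ∈ P.parts, ∑ t ∈ B.powersetCard k, c t =
      ∑ t ∈ (univ : Finset V).powersetCard k, c t * partVec P t := by
  simp only [partVec, mul_ite, mul_one, mul_zero]
  rw [← sum_filter, ← sum_biUnion]
  · congr 1
    ext t
    simp only [mem_biUnion, mem_powersetCard, mem_filter, subset_univ, true_and]
    exact ⟨fun ⟨B, hB, h, h'⟩ => ⟨h', B, hB, h⟩, fun ⟨h', B, hB, h⟩ => ⟨B, hB, h, h'⟩⟩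
  · intro B hB B' hB' hne
    refine disjoint_left.2 fun t ht ht' => hne ?_
    rw [mem_powersetCard] at ht ht'
    obtain ⟨a, ha⟩ := card_ne_zero.1 (ht.2.symm ▸ hk)
    exact P.eq_of_mem_parts hB hB' (ht.1 ha) (ht'.1 ha)

theorem prod_partVec_powersetCard_two (P : Finpartition (univ : Finset V)) {t : Finset V}
    (ht : t.Nonempty) : ∏ e ∈ t.powersetCard 2, partVec P e = partVec P t := by
  by_cases h : ∃ B ∈ P.parts, t ⊆ B
  · have hone : partVec P t = 1 := if_pos h
    obtain ⟨B, hB, htB⟩ := h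
    rw [hone]
    exact prod_eq_one fun e he => if_pos ⟨B, hB, (mem_powersetCard.1 he).1.trans htB⟩
  · have hzero : partVec P t = 0 := if_neg h
    obtain ⟨p, hp⟩ := ht
    rw [exists_part_superset_iff_subset_part P hp, not_subset] at h
    obtain ⟨q, hq, hqp⟩ := h
    have hpq : p ≠ q := by
      rintro rfl
      exact hqp (P.mem_part_self.2 (mem_univ p))
    rw [hzero]
    refine prod_eq_zero (i := {p, q}) ?_ (by rw [partVec_pair, if_neg hqp])
    exact mem_powersetCard.2 ⟨insert_subset hp (singleton_subset_iff.2 hq), card_pair hpq⟩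

theorem partObj_eq_obj (c : Finset V → ℝ) (P : Finpartition (univ : Finset V)) :
    partObj c P = obj c (partVec P) := by
  unfold partObj obj
  rw [sum_parts_powersetCard c P three_ne_zero, sum_parts_powersetCard c P two_ne_zero]
  congr 2
  refine sum_congr rfl fun t ht => ?_
  rw [prod_partVec_powersetCard_two]
  exact card_pos.1 (by rw [(mem_powersetCard.1 ht).2]; norm_num)

theorem obj_congr (c : Finset V → ℝ) {x y : Finset V → ℝ} (h : ∀ e ∈ pairs V, x e = y e) :
    obj c x = obj c y := by
  unfold obj
  congr 2
  · refine sum_congr rfl fun t _ => congrArg _ (prod_congr rfl fun e he => h e ?_)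
    exact mem_powersetCard.2 ⟨subset_univ e, (mem_powersetCard.1 he).2⟩
  · exact sum_congr rfl fun e he => congrArg _ (h e he)

end

/--
The cubic set partition problem can be written as a cubic integer program:
(i) the map `Π ↦ x^Π` sends partitions to feasible vectors;
(ii) it is a bijection onto `X_S` (every feasible `x` agrees on `binom(S,2)` with `x^Π`
for exactly one partition `Π`);
(iii) the two objective values coincide under this map; and
(iv) the minima of the two problems coincide (attained at corresponding solutions).
-/
theorem cubic_set_partition_program {V : Type*} [Fintype V] [DecidableEq V] [Nonempty V]
    (c : Finset V → ℝ) :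
    (∀ P : Finpartition (univ : Finset V), feasible (partVec P)) ∧
    (∀ x : Finset V → ℝ, feasible x →
      ∃! P : Finpartition (univ : Finset V), ∀ e ∈ pairs V, partVec P e = x e) ∧
    (∀ P : Finpartition (univ : Finset V), partObj c P = obj c (partVec P)) ∧
    (∃ (P : Finpartition (univ : Finset V)) (x : Finset V → ℝ),
      feasible x ∧
      (∀ P' : Finpartition (univ : Finset V), partObj c P ≤ partObj c P') ∧
      (∀ x' : Finset V → ℝ, feasible x' → obj c x ≤ obj c x') ∧
      partObj c P = obj c x) := by
  refine ⟨feasible_partVec, fun x hx => ?_, partObj_eq_obj c, ?_⟩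
  · obtain ⟨P, hP⟩ := exists_partVec_eq_on_pairs hx
    exact ⟨P, hP, fun Q hQ =>
      eq_of_partVec_eq_on_pairs fun e he => (hQ e he).trans (hP e he).symm⟩
  · obtain ⟨P, hP⟩ := Finite.exists_min (partObj (V := V) c)
    refine ⟨P, partVec P, feasible_partVec P, hP, fun x hx => ?_, partObj_eq_obj c P⟩
    obtain ⟨Q, hQ⟩ := exists_partVec_eq_on_pairs hx
    rw [← obj_congr c hQ, ← partObj_eq_obj, ← partObj_eq_obj]
    exact hP Q
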